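/- Let k be a positive rational number such that √k is irrational. Then there exists an absolute positive constant c₀ such that for all γ, γ' ∈ (0, 1/10) with γ/γ' < c₀ the following holds: there exist positive constants C = C(k, γ, γ') and χ = χ(γ, γ') such that for every N ∈ [1, ∞) and every ξ in the minor arcs m(N; k, γ, γ'), one has | (1/N) ∑_{n=1}^{⌊N⌋} e(ξ n⌊n√k⌋) | ≤ C N^{−χ}. -/

import Mathlib

/-- `e(x) = exp(2πix)`. -/
noncomputable def expc (x : ℝ) : ℂ := Complex.exp (2 * Real.pi * Complex.I * x)

/-- `‖x‖ = min_{n ∈ ℤ} |x − n|`, the distance from `x` to the nearest integer. -/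
noncomputable def distToInt (x : ℝ) : ℝ := |x - (round x : ℤ)|

/-- Admissible indices `(a, b, q)` for the arcs at scale `N` with parameter `γ`:
`q ∈ {1,…,⌊N^γ⌋}`, `b ∈ ℤ` with `|b| ≤ N^γ`, `a ∈ {1,…,q}` and `gcd(a,b,q) = 1`. -/
def goodIdx (N γ : ℝ) (a b : ℤ) (q : ℕ) : Prop :=
  0 < q ∧ (q : ℝ) ≤ N ^ γ ∧ |(b : ℝ)| ≤ N ^ γ ∧ 1 ≤ a ∧ a ≤ (q : ℤ) ∧
    Int.gcd a (Int.gcd b (q : ℤ)) = 1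

/-- The major arcs `M(N; k, γ, γ')`. -/
noncomputable def majorArcs (k N γ γ' : ℝ) : Set ℝ :=
  {ξ | ξ ∈ Set.Ico (-(1 / 2) : ℝ) (1 / 2) ∧ ∃ (a b : ℤ) (q : ℕ), goodIdx N γ a b q ∧
    distToInt (ξ - ((a : ℝ) + (b : ℝ) * Real.sqrt k) / q) ≤ N ^ (-2 + γ')}

/-- The minor arcs `m(N; k, γ, γ') = [−1/2, 1/2) \ M(N; k, γ, γ')`. -/
noncomputable def minorArcs (k N γ γ' : ℝ) : Set ℝ :=
  Set.Ico (-(1 / 2) : ℝ) (1 / 2) \ majorArcs k N γ γ'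

/-- The exponential sum `(1/N) ∑_{n=1}^{⌊N⌋} e(ξ n⌊n√k⌋)`. -/
noncomputable def expSum (k N ξ : ℝ) : ℂ :=
  ((N : ℝ) : ℂ)⁻¹ * ∑ n ∈ Finset.Icc 1 (⌊N⌋).toNat,
      expc (ξ * ((n : ℝ) * (⌊(n : ℝ) * Real.sqrt k⌋ : ℝ)))

lemma expc_add (x y : ℝ) : expc (x + y) = expc x * expc y := by
  simp only [expc, ← Complex.exp_add]
  push_cast
  ring_nf

lemma expc_intCast (n : ℤ) : expc n = 1 := by
  rw [expc, Complex.exp_eq_one_iff]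
  exact ⟨n, by push_cast; ring⟩

lemma norm_expc (x : ℝ) : ‖expc x‖ = 1 := by
  have h : (2 * Real.pi * Complex.I * x : ℂ) = ((2 * Real.pi * x : ℝ) : ℂ) * Complex.I := by
    push_cast; ring
  rw [expc, h, Complex.norm_exp_ofReal_mul_I]

lemma conj_expc (x : ℝ) : (starRingEnd ℂ) (expc x) = expc (-x) := by
  simp [expc, ← Complex.exp_conj, Complex.conj_ofNat]

lemma distToInt_le_abs_sub (x : ℝ) (n : ℤ) : distToInt x ≤ |x - n| := round_le x n

lemma four_mul_distToInt_le_norm_expc_sub_one (x : ℝ) : 4 * distToInt x ≤ ‖expc x - 1‖ := by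
  set t : ℝ := x - round x with ht
  have hx : expc x = expc t := by
    calc expc x = expc (t + (round x : ℤ)) := by rw [ht, sub_add_cancel]
      _ = expc t := by rw [expc_add, expc_intCast, mul_one]
  have ht2 : |t| ≤ 1 / 2 := abs_sub_round x
  have h : (2 * Real.pi * Complex.I * t : ℂ) = Complex.I * ((2 * Real.pi * t : ℝ) : ℂ) := by
    push_cast; ring
  have hpi := Real.pi_pos
  rw [hx, expc, h, Complex.norm_exp_I_mul_ofReal_sub_one, distToInt, ← ht, Real.norm_eq_abs,
    abs_mul, abs_of_pos (two_pos : (0 : ℝ) < 2)]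
  have h1 : 2 * Real.pi * t / 2 = Real.pi * t := by ring
  have h2 : 2 / Real.pi * (Real.pi * |t|) ≤ Real.sin (Real.pi * |t|) :=
    Real.mul_le_sin (by positivity) (by nlinarith)
  have h3 : 2 / Real.pi * (Real.pi * |t|) = 2 * |t| := by field_simp
  have h4 : Real.sin (Real.pi * |t|) ≤ |Real.sin (Real.pi * t)| := by
    rcases abs_cases t with ⟨h, -⟩ | ⟨h, -⟩ <;> rw [h]
    · exact le_abs_self _
    · rw [mul_neg, Real.sin_neg]; exact neg_le_abs _
  rw [h1]
  linarith

lemma expc_sub_one_mul_sum_Ico (β c : ℝ) (a : ℤ) (n : ℕ) :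
    (expc β - 1) * ∑ x ∈ Finset.Ico a (a + n), expc (β * x + c) =
      expc (β * (a + n) + c) - expc (β * a + c) := by
  induction n with
  | zero => simp
  | succ n ih =>
    have hI : Finset.Ico a (a + (n + 1 : ℕ)) = insert (a + n : ℤ) (Finset.Ico a (a + n)) := by
      ext x; simp only [Finset.mem_Ico, Finset.mem_insert]; push_cast; omega
    rw [hI, Finset.sum_insert (by simp), mul_add, ih]
    have : β * (a + (n + 1 : ℕ)) + c = β + (β * (a + n) + c) := by push_cast; ring
    rw [this, expc_add β]
    push_cast
    ring

lemma norm_sum_expc_le (I : Finset ℤ)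
    (hI : ∀ x ∈ I, ∀ z ∈ I, ∀ y, x ≤ y → y ≤ z → y ∈ I) (β c τ : ℝ) (hτ : 0 < τ)
    (h : τ < distToInt β) : ‖∑ x ∈ I, expc (β * x + c)‖ ≤ 1 / (2 * τ) := by
  rcases I.eq_empty_or_nonempty with rfl | hne
  · simp; positivity
  obtain ⟨n, hn⟩ : ∃ n : ℕ, I.max' hne + 1 = I.min' hne + n :=
    ⟨(I.max' hne + 1 - I.min' hne).toNat, by have := I.min'_le_max' hne; omega⟩
  have hIco : I = Finset.Ico (I.min' hne) (I.min' hne + n) := by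
    ext x
    rw [← hn, Finset.mem_Ico, Int.lt_add_one_iff]
    exact ⟨fun hx => ⟨I.min'_le x hx, I.le_max' x hx⟩,
      fun hx => hI _ (I.min'_mem hne) _ (I.max'_mem hne) x hx.1 hx.2⟩
  have key := congrArg norm (expc_sub_one_mul_sum_Ico β c (I.min' hne) n)
  rw [← hIco, norm_mul] at key
  have h2 := norm_sub_le (expc (β * ((I.min' hne : ℤ) + n) + c)) (expc (β * (I.min' hne : ℤ) + c))
  rw [← key, norm_expc, norm_expc] at h2
  have h3 := four_mul_distToInt_le_norm_expc_sub_one β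
  rw [le_div_iff₀ (by positivity)]
  nlinarith [norm_nonneg (∑ x ∈ I, expc (β * x + c))]

lemma card_Icc_floor_le (x y : ℝ) (h : x ≤ y) :
    ((Finset.Icc ⌊x⌋ ⌊y⌋).card : ℝ) ≤ y - x + 2 := by
  have h1 : ⌊x⌋ ≤ ⌊y⌋ := Int.floor_le_floor h
  have h2 : ((Finset.Icc ⌊x⌋ ⌊y⌋).card : ℤ) = ⌊y⌋ + 1 - ⌊x⌋ := by
    rw [Int.card_Icc]; omega
  have h3 : ((Finset.Icc ⌊x⌋ ⌊y⌋).card : ℝ) = ⌊y⌋ + 1 - ⌊x⌋ := by exact_mod_cast h2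
  rw [h3]
  linarith [Int.floor_le y, Int.lt_floor_add_one x]

lemma exists_close_pair (X B : ℝ) (hB : 0 < B) (hX : 4 * B < X) (H : Finset ℤ)
    (hH : ∀ h ∈ H, |(h : ℝ)| ≤ X) (hcard : X / B ≤ H.card) :
    ∃ h ∈ H, ∃ h' ∈ H, h < h' ∧ (h' - h : ℝ) ≤ 4 * B := by
  have hmap : ∀ h ∈ H, ⌊(h : ℝ) / (4 * B)⌋ ∈ Finset.Icc ⌊-X / (4 * B)⌋ ⌊X / (4 * B)⌋ := by
    intro h hh
    have := abs_le.mp (hH h hh)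
    rw [Finset.mem_Icc]
    constructor <;> apply Int.floor_le_floor <;> gcongr <;> linarith
  have hlt : (Finset.Icc ⌊-X / (4 * B)⌋ ⌊X / (4 * B)⌋).card < H.card := by
    have h1 := card_Icc_floor_le (-X / (4 * B)) (X / (4 * B)) (by gcongr; linarith)
    have h2 : X / (4 * B) - -X / (4 * B) + 2 < X / B := by
      have : X / B - (X / (4 * B) - -X / (4 * B) + 2) = (X - 4 * B) / (2 * B) := by
        field_simp; ring
      have : 0 < (X - 4 * B) / (2 * B) := div_pos (by linarith) (by linarith)
      linarith
    exact_mod_cast h1.trans_lt (h2.trans_le hcard)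
  obtain ⟨x, hx, y, hy, hne, hxy⟩ := Finset.exists_ne_map_eq_of_card_lt_of_maps_to hlt hmap
  have habs := Int.abs_sub_lt_one_of_floor_eq_floor hxy
  rw [← sub_div, abs_div, abs_of_pos (by linarith : 0 < 4 * B), div_lt_one (by linarith)] at habs
  have := abs_lt.mp habs
  rcases lt_or_gt_of_ne hne with h | h
  · exact ⟨x, hx, y, hy, h, by linarith⟩
  · exact ⟨y, hy, x, hx, h, by linarith⟩

lemma exists_far_pair (F : Finset ℤ) (c : ℝ) (hc : 1 < c) (hF : c ≤ F.card) :
    ∃ h ∈ F, ∃ h' ∈ F, c - 1 ≤ (h' - h : ℝ) := by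
  have hne : F.Nonempty := by
    rw [← Finset.card_pos]
    have : (0 : ℝ) < F.card := by linarith
    exact_mod_cast this
  refine ⟨F.min' hne, F.min'_mem hne, F.max' hne, F.max'_mem hne, ?_⟩
  have h1 : F ⊆ Finset.Icc (F.min' hne) (F.max' hne) := fun x hx =>
    Finset.mem_Icc.mpr ⟨F.min'_le x hx, F.le_max' x hx⟩
  have h2 := Finset.card_le_card h1
  have h3 := F.min'_le_max' hne
  rw [Int.card_Icc] at h2
  have h4 : (F.card : ℤ) ≤ F.max' hne + 1 - F.min' hne := by omega
  have h5 : (F.card : ℝ) ≤ F.max' hne + 1 - F.min' hne := by exact_mod_cast h4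
  linarith

/-- If many integers `h` of size at most `X` make `β * h` close to an integer, then `β` is close
to a rational with small denominator. -/
lemma exists_small_denominator (β X B : ℝ) (hB : 1 ≤ B) (hX : 56 * B ^ 2 ≤ X) (H : Finset ℤ)
    (hH : ∀ h ∈ H, |(h : ℝ)| ≤ X) (hβ : ∀ h ∈ H, distToInt (β * h) ≤ B / X)
    (hcard : X / B ≤ H.card) :
    ∃ q : ℕ, 0 < q ∧ (q : ℝ) ≤ 4 * B ∧ ∃ a : ℤ, |q * β - a| ≤ 64 * B ^ 4 / X ^ 2 := by
  have hBB : B ≤ B ^ 2 := by nlinarith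
  have hX0 : 0 < X := by nlinarith
  obtain ⟨h₁, hh₁, h₂, hh₂, hlt, hle⟩ :=
    exists_close_pair X B (by linarith) (by nlinarith) H hH hcard
  obtain ⟨d, hd⟩ : ∃ d : ℕ, (d : ℤ) = h₂ - h₁ := ⟨(h₂ - h₁).toNat, by omega⟩
  have hdR : (d : ℝ) = h₂ - h₁ := by exact_mod_cast hd
  have hd1 : (1 : ℝ) ≤ d := by
    have : 1 ≤ d := by omega
    exact_mod_cast this
  have hd4 : (d : ℝ) ≤ 4 * B := by rw [hdR]; exact hle
  set a : ℤ := round (β * h₂) - round (β * h₁) with ha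
  set η : ℝ := d * β - a with hη
  have e1 := abs_le.mp (hβ h₁ hh₁)
  have e2 := abs_le.mp (hβ h₂ hh₂)
  have hη1 : |η| ≤ 2 * (B / X) := by
    have : η = (β * h₂ - round (β * h₂)) - (β * h₁ - round (β * h₁)) := by
      rw [hη, hdR, ha]; push_cast; ring
    rw [this, abs_le]
    constructor <;> linarith
  let g : ℤ → ℤ := fun h => d * round (β * h) - a * h
  have hg : ∀ h ∈ H, |(g h : ℝ) - η * h| ≤ d * (B / X) := by
    intro h hh
    have : (g h : ℝ) - η * h = -(d * (β * h - round (β * h))) := by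
      simp only [g, hη]; push_cast; ring
    rw [this, abs_neg, abs_mul, abs_of_nonneg (by linarith : (0 : ℝ) ≤ d)]
    exact mul_le_mul_of_nonneg_left (hβ h hh) (by linarith)
  have hdB : d * (B / X) ≤ B / 2 := by
    calc d * (B / X) ≤ 4 * B * (B / X) := by gcongr
      _ = 4 * B ^ 2 / X := by ring
      _ ≤ B / 2 := by rw [div_le_iff₀ hX0]; nlinarith
  have hmap : ∀ h ∈ H, g h ∈ Finset.Icc ⌊-(5 / 2 * B)⌋ ⌊5 / 2 * B⌋ := by
    intro h hh
    have h1 : |η * h| ≤ 2 * B := by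
      rw [abs_mul]
      calc |η| * |(h : ℝ)| ≤ 2 * (B / X) * X := by gcongr; exact hH h hh
        _ = 2 * B := by field_simp
    have h2 := abs_le.mp h1
    have h3 := abs_le.mp (hg h hh)
    have h4 : (g h : ℝ) ≤ 5 / 2 * B := by linarith
    have h5 : -(5 / 2 * B) ≤ (g h : ℝ) := by linarith
    rw [Finset.mem_Icc]
    refine ⟨?_, Int.le_floor.mpr h4⟩
    exact_mod_cast (Int.floor_le _).trans h5
  have hnum : ((Finset.Icc ⌊-(5 / 2 * B)⌋ ⌊5 / 2 * B⌋).card : ℝ) ≤ 7 * B := by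
    linarith [card_Icc_floor_le (-(5 / 2 * B)) (5 / 2 * B) (by linarith)]
  have hpig : (Finset.Icc ⌊-(5 / 2 * B)⌋ ⌊5 / 2 * B⌋).card • (X / (7 * B ^ 2)) ≤ (H.card : ℝ) := by
    rw [nsmul_eq_mul]
    calc _ ≤ 7 * B * (X / (7 * B ^ 2)) := by gcongr
      _ = X / B := by field_simp
      _ ≤ _ := hcard
  have hne : (Finset.Icc ⌊-(5 / 2 * B)⌋ ⌊5 / 2 * B⌋).Nonempty := ⟨_, hmap h₁ hh₁⟩
  obtain ⟨y, -, hy⟩ :=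
    Finset.exists_le_card_fiber_of_nsmul_le_card_of_maps_to hmap hne hpig
  have h8 : 8 ≤ X / (7 * B ^ 2) := by rw [le_div_iff₀ (by positivity)]; linarith
  obtain ⟨u, hu, v, hv, huv⟩ := exists_far_pair _ _ (by linarith) hy
  rw [Finset.mem_filter] at hu hv
  have h9 : X / (8 * B ^ 2) ≤ (v - u : ℝ) := by
    have : X / (8 * B ^ 2) = X / (7 * B ^ 2) * (7 / 8) := by field_simp
    linarith
  refine ⟨d, by omega, hd4, a, ?_⟩
  have gu := abs_le.mp (hg u hu.1)
  have gv := abs_le.mp (hg v hv.1)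
  rw [hu.2] at gu
  rw [hv.2] at gv
  have h10 : |η * (v - u : ℝ)| ≤ 8 * B ^ 2 / X := by
    have : d * (B / X) ≤ 4 * B ^ 2 / X := by
      calc d * (B / X) ≤ 4 * B * (B / X) := by gcongr
        _ = 4 * B ^ 2 / X := by ring
    have h11 : 8 * B ^ 2 / X = 2 * (4 * B ^ 2 / X) := by ring
    rw [abs_le, h11]
    constructor <;> linarith
  have hpos : 0 < X / (8 * B ^ 2) := by positivity
  rw [abs_mul, abs_of_pos (hpos.trans_le h9)] at h10
  have h12 : |η| * (X / (8 * B ^ 2)) ≤ 8 * B ^ 2 / X :=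
    (mul_le_mul_of_nonneg_left h9 (abs_nonneg _)).trans h10
  rw [← le_div_iff₀ hpos] at h12
  calc |η| ≤ _ := h12
    _ = 64 * B ^ 4 / X ^ 2 := by field_simp; norm_num

/-- The binary quadratic form `θ₁ x² + θ₂ x y + θ₃ y²`. -/
noncomputable def quadPhase (θ₁ θ₂ θ₃ : ℝ) (u : ℤ × ℤ) : ℝ :=
  θ₁ * u.1 ^ 2 + θ₂ * (u.1 * u.2) + θ₃ * u.2 ^ 2

open Classical in
lemma norm_fiber_sum_le (Ω : Finset (ℤ × ℤ)) (L : ℕ) (hL : 1 ≤ L)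
    (box : ∀ u ∈ Ω, |u.1| ≤ L ∧ |u.2| ≤ L)
    (conv : ∀ y x₁ x₂ x₃, (x₁, y) ∈ Ω → (x₃, y) ∈ Ω → x₁ ≤ x₂ → x₂ ≤ x₃ → (x₂, y) ∈ Ω)
    (θ₁ θ₂ θ₃ τ : ℝ) (hτ : 0 < τ) (h : ℤ × ℤ) (y : ℤ) :
    ‖∑ w ∈ Ω ×ˢ Ω with (w.2 - w.1, w.1.2) = (h, y),
        expc (quadPhase θ₁ θ₂ θ₃ w.2 - quadPhase θ₁ θ₂ θ₃ w.1)‖ ≤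
      if distToInt (2 * θ₁ * h.1 + θ₂ * h.2) ≤ τ then 3 * (L : ℝ) else 1 / (2 * τ) := by
  obtain ⟨h₁, h₂⟩ := h
  set I : Finset ℤ := (Finset.Icc (-(L : ℤ)) L).filter
    fun x => (x, y) ∈ Ω ∧ (x + h₁, y + h₂) ∈ Ω with hI
  set β : ℝ := 2 * θ₁ * h₁ + θ₂ * h₂ with hβ
  set c : ℝ := θ₁ * h₁ ^ 2 + θ₂ * (h₁ * (y + h₂)) + θ₃ * (2 * y * h₂ + h₂ ^ 2) with hc
  have hsum : ∑ w ∈ Ω ×ˢ Ω with (w.2 - w.1, w.1.2) = ((h₁, h₂), y),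
      expc (quadPhase θ₁ θ₂ θ₃ w.2 - quadPhase θ₁ θ₂ θ₃ w.1) = ∑ x ∈ I, expc (β * x + c) := by
    refine Finset.sum_nbij' (fun w => w.1.1) (fun x => ((x, y), (x + h₁, y + h₂))) ?_ ?_ ?_ ?_ ?_
    · rintro ⟨⟨x, y'⟩, ⟨x', y''⟩⟩ hw
      simp only [Finset.mem_filter, Finset.mem_product, Prod.mk.injEq, Prod.mk_sub_mk] at hw
      obtain ⟨⟨hu, hu'⟩, ⟨e1, e2⟩, rfl⟩ := hw
      obtain rfl : x' = x + h₁ := by omega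
      obtain rfl : y'' = y' + h₂ := by omega
      have := abs_le.mp (box _ hu).1
      simp only [hI, Finset.mem_filter, Finset.mem_Icc]
      exact ⟨this, hu, hu'⟩
    · intro x hx
      simp only [hI, Finset.mem_filter] at hx
      simp only [Finset.mem_filter, Finset.mem_product, Prod.mk.injEq, Prod.mk_sub_mk]
      exact ⟨hx.2, ⟨by ring, by ring⟩, trivial⟩
    · rintro ⟨⟨x, y'⟩, ⟨x', y''⟩⟩ hw
      simp only [Finset.mem_filter, Finset.mem_product, Prod.mk.injEq, Prod.mk_sub_mk] at hw
      obtain ⟨⟨hu, hu'⟩, ⟨e1, e2⟩, rfl⟩ := hw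
      simp only [Prod.mk.injEq, true_and]
      omega
    · intro x hx
      rfl
    · rintro ⟨⟨x, y'⟩, ⟨x', y''⟩⟩ hw
      simp only [Finset.mem_filter, Finset.mem_product, Prod.mk.injEq, Prod.mk_sub_mk] at hw
      obtain ⟨⟨hu, hu'⟩, ⟨e1, e2⟩, rfl⟩ := hw
      obtain rfl : x' = x + h₁ := by omega
      obtain rfl : y'' = y' + h₂ := by omega
      congr 1
      simp only [quadPhase, hβ, hc]
      push_cast
      ring
  rw [hsum]
  split_ifs with hgood
  · calc ‖∑ x ∈ I, expc (β * x + c)‖ ≤ ∑ x ∈ I, ‖expc (β * x + c)‖ := norm_sum_le _ _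
      _ = I.card := by simp [norm_expc]
      _ ≤ (Finset.Icc (-(L : ℤ)) L).card := by exact_mod_cast Finset.card_filter_le _ _
      _ ≤ 3 * (L : ℝ) := by
        rw [Int.card_Icc]
        have : (L + 1 - -(L : ℤ)).toNat ≤ 3 * L := by omega
        exact_mod_cast this
  · refine norm_sum_expc_le I ?_ β c τ hτ (not_le.mp hgood)
    intro x hx z hz x' h1 h2
    simp only [hI, Finset.mem_filter, Finset.mem_Icc] at hx hz ⊢
    exact ⟨by omega, conv y x x' z hx.2.1 hz.2.1 h1 h2,
      conv (y + h₂) (x + h₁) (x' + h₁) (z + h₁) hx.2.2 hz.2.2 (by omega) (by omega)⟩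

open Classical in
/-- Weyl differencing for a quadratic exponential sum over a planar region whose horizontal
slices are intervals. -/
lemma norm_sq_sum_quadPhase_le (Ω : Finset (ℤ × ℤ)) (L : ℕ) (hL : 1 ≤ L)
    (box : ∀ u ∈ Ω, |u.1| ≤ L ∧ |u.2| ≤ L)
    (conv : ∀ y x₁ x₂ x₃, (x₁, y) ∈ Ω → (x₃, y) ∈ Ω → x₁ ≤ x₂ → x₂ ≤ x₃ → (x₂, y) ∈ Ω)
    (θ₁ θ₂ θ₃ τ : ℝ) (hτ : 0 < τ) :
    ‖∑ u ∈ Ω, expc (quadPhase θ₁ θ₂ θ₃ u)‖ ^ 2 ≤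
      3 * L * (3 * L * (((Finset.Icc (-(2 * L : ℤ)) (2 * L) ×ˢ
        Finset.Icc (-(2 * L : ℤ)) (2 * L)).filter
          fun h => distToInt (2 * θ₁ * h.1 + θ₂ * h.2) ≤ τ).card : ℝ) +
        25 * L ^ 2 / (2 * τ)) := by
  set J := Finset.Icc (-(2 * L : ℤ)) (2 * L) ×ˢ Finset.Icc (-(2 * L : ℤ)) (2 * L) with hJ
  set Y := Finset.Icc (-(L : ℤ)) L with hY
  set P : ℤ × ℤ → ℝ := quadPhase θ₁ θ₂ θ₃ with hP
  have hYc : (Y.card : ℝ) ≤ 3 * L := by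
    rw [hY, Int.card_Icc]
    have : (L + 1 - -(L : ℤ)).toNat ≤ 3 * L := by omega
    exact_mod_cast this
  have hJc : (J.card : ℝ) ≤ 25 * L ^ 2 := by
    rw [hJ, Finset.card_product, Int.card_Icc]
    have : (2 * L + 1 - -(2 * L : ℤ)).toNat ≤ 5 * L := by omega
    have h2 := Nat.mul_le_mul this this
    have h3 : 5 * L * (5 * L) = 25 * L ^ 2 := by ring
    rw [h3] at h2
    exact_mod_cast h2
  have h1 : ‖∑ u ∈ Ω, expc (P u)‖ ^ 2 = ‖∑ w ∈ Ω ×ˢ Ω, expc (P w.2 - P w.1)‖ := by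
    have : ∑ w ∈ Ω ×ˢ Ω, expc (P w.2 - P w.1) =
        (starRingEnd ℂ) (∑ u ∈ Ω, expc (P u)) * ∑ u ∈ Ω, expc (P u) := by
      rw [map_sum, Finset.sum_mul_sum, Finset.sum_product]
      refine Finset.sum_congr rfl fun u _ => Finset.sum_congr rfl fun v _ => ?_
      rw [conj_expc, ← expc_add]
      congr 1
      ring
    rw [this, norm_mul, RCLike.norm_conj, sq]
  have hmap : ∀ w ∈ Ω ×ˢ Ω, (fun w : (ℤ × ℤ) × (ℤ × ℤ) => (w.2 - w.1, w.1.2)) w ∈ J ×ˢ Y := by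
    rintro ⟨u, v⟩ hw
    rw [Finset.mem_product] at hw
    have hu := box u hw.1
    have hv := box v hw.2
    simp only [abs_le] at hu hv
    simp only [hJ, hY, Finset.mem_product, Finset.mem_Icc, Prod.fst_sub, Prod.snd_sub]
    omega
  rw [h1, ← Finset.sum_fiberwise_of_maps_to hmap]
  refine (norm_sum_le _ _).trans ?_
  calc _ ≤ ∑ z ∈ J ×ˢ Y,
        if distToInt (2 * θ₁ * z.1.1 + θ₂ * z.1.2) ≤ τ then 3 * (L : ℝ) else 1 / (2 * τ) :=
        Finset.sum_le_sum fun z _ =>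
          norm_fiber_sum_le Ω L hL box conv θ₁ θ₂ θ₃ τ hτ z.1 z.2
    _ = Y.card * ∑ h ∈ J,
        if distToInt (2 * θ₁ * h.1 + θ₂ * h.2) ≤ τ then 3 * (L : ℝ) else 1 / (2 * τ) := by
      rw [Finset.sum_product, Finset.mul_sum]
      simp
    _ ≤ 3 * L * ∑ h ∈ J, ((if distToInt (2 * θ₁ * h.1 + θ₂ * h.2) ≤ τ then 3 * (L : ℝ) else 0) +
        1 / (2 * τ)) := by
      have hpos : 0 ≤ 1 / (2 * τ) := by positivity
      refine mul_le_mul hYc (Finset.sum_le_sum fun h _ => ?_)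
        (Finset.sum_nonneg fun h _ => ?_) (by positivity)
      · split_ifs <;> linarith
      · split_ifs <;> positivity
    _ ≤ _ := by
      rw [Finset.sum_add_distrib, ← Finset.sum_filter, Finset.sum_const, Finset.sum_const,
        nsmul_eq_mul, nsmul_eq_mul]
      have : (J.card : ℝ) * (1 / (2 * τ)) ≤ 25 * L ^ 2 / (2 * τ) := by
        rw [mul_one_div]; gcongr
      refine mul_le_mul_of_nonneg_left ?_ (by positivity)
      linarith

/-- A set of `≥ L² / (18 B₀²)` points of the box `[-2L, 2L]²` at which `β₁ x + β₂ y` is close to an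
integer forces `β₁` to be close to a rational with small denominator. -/
lemma exists_small_denominator_of_box (β₁ β₂ B₀ : ℝ) (L : ℕ) (hB : 1 ≤ B₀)
    (hL : 14 * 360000 * B₀ ^ 4 ≤ L) (G : Finset (ℤ × ℤ))
    (hG : ∀ h ∈ G, (-(2 * L : ℤ) ≤ h.1 ∧ h.1 ≤ 2 * L) ∧ (-(2 * L : ℤ) ≤ h.2 ∧ h.2 ≤ 2 * L))
    (hd : ∀ h ∈ G, distToInt (β₁ * h.1 + β₂ * h.2) ≤ 75 * B₀ ^ 2 / L)
    (hcard : (L : ℝ) ^ 2 / (18 * B₀ ^ 2) ≤ G.card) :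
    ∃ q : ℕ, 0 < q ∧ (q : ℝ) ≤ 4 * (600 * B₀ ^ 2) ∧ ∃ a : ℤ,
      |q * β₁ - a| ≤ 64 * (600 * B₀ ^ 2) ^ 4 / (4 * L) ^ 2 := by
  have hB4 : 1 ≤ B₀ ^ 4 := one_le_pow₀ hB
  have hB2 : 1 ≤ B₀ ^ 2 := one_le_pow₀ hB
  have hL0 : (0 : ℝ) < L := by linarith
  have hL1 : 1 ≤ L := by exact_mod_cast hL0
  have hmap : ∀ h ∈ G, h.2 ∈ Finset.Icc (-(2 * L : ℤ)) (2 * L) := fun h hh =>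
    Finset.mem_Icc.mpr (hG h hh).2
  have hYc : ((Finset.Icc (-(2 * L : ℤ)) (2 * L)).card : ℝ) ≤ 5 * L := by
    rw [Int.card_Icc]
    have : (2 * L + 1 - -(2 * L : ℤ)).toNat ≤ 5 * L := by omega
    exact_mod_cast this
  have hpig : (Finset.Icc (-(2 * L : ℤ)) (2 * L)).card • ((L : ℝ) / (90 * B₀ ^ 2)) ≤ G.card := by
    rw [nsmul_eq_mul]
    calc _ ≤ 5 * L * ((L : ℝ) / (90 * B₀ ^ 2)) := by gcongr
      _ = (L : ℝ) ^ 2 / (18 * B₀ ^ 2) := by field_simp; norm_num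
      _ ≤ _ := hcard
  obtain ⟨y, -, hy⟩ := Finset.exists_le_card_fiber_of_nsmul_le_card_of_maps_to hmap
    (Finset.nonempty_Icc.mpr (by omega)) hpig
  set F := G.filter fun h => h.2 = y with hF
  have hFne : F.Nonempty := by
    rw [← Finset.card_pos]
    have : (0 : ℝ) < F.card := lt_of_lt_of_le (by positivity) hy
    exact_mod_cast this
  obtain ⟨⟨x₀, y₀⟩, h₀⟩ := hFne
  obtain ⟨hp₀, hy₀⟩ : (x₀, y₀) ∈ G ∧ y₀ = y := by simpa [hF] using h₀
  have hinj : Set.InjOn (fun h : ℤ × ℤ => h.1 - x₀) F := by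
    rintro ⟨a, b⟩ ha ⟨a', b'⟩ ha' haa
    simp only [hF, Finset.coe_filter, Set.mem_ofPred_eq] at ha ha' haa
    rw [ha.2, ha'.2]
    congr 1
    omega
  refine exists_small_denominator β₁ (4 * L) (600 * B₀ ^ 2) (by linarith) ?_
    (F.image fun h => h.1 - x₀) ?_ ?_ ?_
  · nlinarith
  · intro h hh
    obtain ⟨⟨x, y'⟩, hxF, rfl⟩ := Finset.mem_image.mp hh
    obtain ⟨hxy, -⟩ := Finset.mem_filter.mp hxF
    have h1 := hG _ hxy
    have h2 := hG _ hp₀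
    have : |x - x₀| ≤ 4 * L := by rw [abs_le]; simp only at h1 h2; omega
    exact_mod_cast this
  · intro h hh
    obtain ⟨⟨x, y'⟩, hxF, rfl⟩ := Finset.mem_image.mp hh
    obtain ⟨hxy, hyy⟩ := Finset.mem_filter.mp hxF
    obtain rfl : y' = y := hyy
    subst hy₀
    have h1 := abs_le.mp (hd _ hxy)
    have h2 := abs_le.mp (hd _ hp₀)
    refine (distToInt_le_abs_sub _
      (round (β₁ * x + β₂ * y₀) - round (β₁ * x₀ + β₂ * y₀))).trans ?_
    have h3 : 600 * B₀ ^ 2 / (4 * L) = 75 * B₀ ^ 2 / L + 75 * B₀ ^ 2 / L := by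
      field_simp; norm_num
    push_cast
    simp only at h1 h2
    rw [h3, abs_le]
    constructor <;> linarith
  · rw [Finset.card_image_of_injOn hinj]
    refine le_trans ?_ hy
    have : (4 * L : ℝ) / (600 * B₀ ^ 2) = L / (150 * B₀ ^ 2) := by field_simp; norm_num
    rw [this]
    gcongr
    norm_num

/-- A quadratic Weyl sum of large size over a planar region forces its first two coefficients to be
simultaneously close to rationals with a common small denominator. -/
lemma exists_common_denominator (Ω : Finset (ℤ × ℤ)) (L : ℕ) (B₀ : ℝ) (hB : 1 ≤ B₀)
    (hL : 14 * 360000 * B₀ ^ 4 ≤ L)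
    (box : ∀ u ∈ Ω, |u.1| ≤ L ∧ |u.2| ≤ L)
    (conv : ∀ y x₁ x₂ x₃, (x₁, y) ∈ Ω → (x₃, y) ∈ Ω → x₁ ≤ x₂ → x₂ ≤ x₃ → (x₂, y) ∈ Ω)
    (θ₁ θ₂ θ₃ : ℝ) (hS : L ^ 2 / B₀ ≤ ‖∑ u ∈ Ω, expc (quadPhase θ₁ θ₂ θ₃ u)‖) :
    ∃ q : ℕ, 0 < q ∧ (q : ℝ) ≤ 16 * (600 * B₀ ^ 2) ^ 2 ∧ ∃ a₁ a₂ : ℤ,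
      |q * (2 * θ₁) - a₁| ≤ 16 * (600 * B₀ ^ 2) ^ 5 / L ^ 2 ∧
      |q * θ₂ - a₂| ≤ 16 * (600 * B₀ ^ 2) ^ 5 / L ^ 2 := by
  classical
  have hB4 : 1 ≤ B₀ ^ 4 := one_le_pow₀ hB
  have hB2 : 1 ≤ B₀ ^ 2 := one_le_pow₀ hB
  have hL0 : (0 : ℝ) < L := by linarith
  have hL1 : 1 ≤ L := by exact_mod_cast hL0
  have key := norm_sq_sum_quadPhase_le Ω L hL1 box conv θ₁ θ₂ θ₃ (75 * B₀ ^ 2 / L) (by positivity)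
  set G := (Finset.Icc (-(2 * L : ℤ)) (2 * L) ×ˢ Finset.Icc (-(2 * L : ℤ)) (2 * L)).filter
    fun h => distToInt (2 * θ₁ * h.1 + θ₂ * h.2) ≤ 75 * B₀ ^ 2 / L with hG
  have hcard : (L : ℝ) ^ 2 / (18 * B₀ ^ 2) ≤ G.card := by
    have h1 : (L ^ 2 / B₀ : ℝ) ^ 2 ≤ _ := (pow_le_pow_left₀ (by positivity) hS 2).trans key
    have h2 : (3 * L * (3 * L * (G.card : ℝ) + 25 * L ^ 2 / (2 * (75 * B₀ ^ 2 / L)))) =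
        9 * L ^ 2 * G.card + (L ^ 2 / B₀ : ℝ) ^ 2 / 2 := by field_simp; ring
    rw [h2] at h1
    have h3 : (L : ℝ) ^ 2 / (18 * B₀ ^ 2) = (L ^ 2 / B₀ : ℝ) ^ 2 / 2 / (9 * L ^ 2) := by
      field_simp; norm_num
    rw [h3, div_le_iff₀ (by positivity)]
    linarith
  have hGbox : ∀ h ∈ G, (-(2 * L : ℤ) ≤ h.1 ∧ h.1 ≤ 2 * L) ∧
      (-(2 * L : ℤ) ≤ h.2 ∧ h.2 ≤ 2 * L) := by
    intro h hh
    simpa only [Finset.mem_product, Finset.mem_Icc] using (Finset.mem_filter.mp hh).1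
  have hGd : ∀ h ∈ G, distToInt (2 * θ₁ * h.1 + θ₂ * h.2) ≤ 75 * B₀ ^ 2 / L := fun h hh =>
    (Finset.mem_filter.mp hh).2
  obtain ⟨q₁, hq₁, hq₁B, a₁, ha₁⟩ :=
    exists_small_denominator_of_box (2 * θ₁) θ₂ B₀ L hB hL G hGbox hGd hcard
  obtain ⟨q₂, hq₂, hq₂B, a₂, ha₂⟩ :=
    exists_small_denominator_of_box θ₂ (2 * θ₁) B₀ L hB hL (G.image Prod.swap)
      (by
        intro h hh
        obtain ⟨h', hh', rfl⟩ := Finset.mem_image.mp hh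
        exact (hGbox h' hh').symm)
      (by
        intro h hh
        obtain ⟨h', hh', rfl⟩ := Finset.mem_image.mp hh
        rw [add_comm]
        exact hGd h' hh')
      (by rwa [Finset.card_image_of_injective _ Prod.swap_injective])
  have hpos : (0 : ℝ) < 600 * B₀ ^ 2 := by positivity
  have herr : 4 * (600 * B₀ ^ 2) * (64 * (600 * B₀ ^ 2) ^ 4 / (4 * L) ^ 2) =
      16 * (600 * B₀ ^ 2) ^ 5 / L ^ 2 := by field_simp; norm_num
  refine ⟨q₁ * q₂, by positivity, ?_, q₂ * a₁, q₁ * a₂, ?_, ?_⟩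
  · push_cast
    calc (q₁ * q₂ : ℝ) ≤ (4 * (600 * B₀ ^ 2)) * (4 * (600 * B₀ ^ 2)) := by gcongr
      _ = _ := by ring
  · have : ((q₁ * q₂ : ℕ) : ℝ) * (2 * θ₁) - ((q₂ * a₁ : ℤ) : ℝ) = q₂ * (q₁ * (2 * θ₁) - a₁) := by
      push_cast; ring
    rw [this, abs_mul, Nat.abs_cast, ← herr]
    gcongr
  · have : ((q₁ * q₂ : ℕ) : ℝ) * θ₂ - ((q₁ * a₂ : ℤ) : ℝ) = q₁ * (q₂ * θ₂ - a₂) := by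
      push_cast; ring
    rw [this, abs_mul, Nat.abs_cast, ← herr]
    gcongr

lemma affine_nonneg_of_between {A c x₁ x₂ x₃ : ℝ} (h₁₂ : x₁ ≤ x₂) (h₂₃ : x₂ ≤ x₃)
    (h₁ : 0 ≤ A * x₁ + c) (h₃ : 0 ≤ A * x₃ + c) : 0 ≤ A * x₂ + c := by
  rcases le_total 0 A with h | h <;> nlinarith

lemma affine_pos_of_between {A c x₁ x₂ x₃ : ℝ} (h₁₂ : x₁ ≤ x₂) (h₂₃ : x₂ ≤ x₃)
    (h₁ : 0 < A * x₁ + c) (h₃ : 0 < A * x₃ + c) : 0 < A * x₂ + c := by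
  rcases le_total 0 A with h | h <;> nlinarith

/-- The points `(n, ⌊n α⌋)`, `1 ≤ n ≤ M`, in the coordinates obtained by multiplying by the
conjugate of the unit `p + r √(ρ s)`. -/
noncomputable def beattyPoint (s ρ p r : ℤ) (α : ℝ) (n : ℕ) : ℤ × ℤ :=
  (p * ⌊n * α⌋ - ρ * r * n, -(s * r) * ⌊n * α⌋ + p * n)

lemma mem_image_beattyPoint_iff (s ρ p r : ℤ) (hpell : p ^ 2 - ρ * s * r ^ 2 = 1) (α : ℝ) (M : ℕ)
    (x y : ℤ) :
    (x, y) ∈ (Finset.Icc 1 M).image (beattyPoint s ρ p r α) ↔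
      (0 ≤ ((s * r : ℤ) : ℝ) * x + ((p * y - 1 : ℤ) : ℝ) ∧
        0 ≤ ((-(s * r) : ℤ) : ℝ) * x + ((M - p * y : ℤ) : ℝ)) ∧
      0 ≤ (s * r * α - p) * x + (p * y * α - ρ * r * y) ∧
      0 < (p - s * r * α) * x + (1 + ρ * r * y - p * y * α) := by
  rw [Finset.mem_image]
  constructor
  · rintro ⟨n, hn, hxy⟩
    rw [Finset.mem_Icc] at hn
    simp only [beattyPoint, Prod.mk.injEq] at hxy
    obtain ⟨rfl, rfl⟩ := hxy
    have hn1 : (1 : ℝ) ≤ n := by exact_mod_cast hn.1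
    have hn2 : (n : ℝ) ≤ M := by exact_mod_cast hn.2
    have hp : (p : ℝ) ^ 2 - ρ * s * r ^ 2 = 1 := by exact_mod_cast hpell
    have h1 := Int.floor_le ((n : ℝ) * α)
    have h2 := Int.lt_floor_add_one ((n : ℝ) * α)
    set m : ℤ := ⌊(n : ℝ) * α⌋
    have e1 : (s * r : ℝ) * (p * m - ρ * r * n) + p * (-(s * r) * m + p * n) = n := by
      linear_combination (n : ℝ) * hp
    have e2 : (p : ℝ) * (p * m - ρ * r * n) + ρ * r * (-(s * r) * m + p * n) = m := by
      linear_combination (m : ℝ) * hp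
    push_cast
    refine ⟨⟨by linarith, by linarith⟩, ?_, ?_⟩
    · have : (s * r * α - p) * (p * m - ρ * r * n) +
          (p * (-(s * r) * m + p * n) * α - ρ * r * (-(s * r) * m + p * n)) = n * α - m := by
        linear_combination α * e1 - e2
      rw [this]; linarith
    · have : (p - s * r * α) * (p * m - ρ * r * n) +
          (1 + ρ * r * (-(s * r) * m + p * n) - p * (-(s * r) * m + p * n) * α) =
            1 - (n * α - m) := by
        linear_combination e2 - α * e1
      rw [this]; linarith
  · rintro ⟨⟨h1, h2⟩, h3, h4⟩
    have h1' : 0 ≤ s * r * x + (p * y - 1) := by exact_mod_cast h1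
    have h2' : 0 ≤ -(s * r) * x + (M - p * y) := by exact_mod_cast h2
    obtain ⟨n, hn⟩ : ∃ n : ℕ, (n : ℤ) = s * r * x + p * y :=
      ⟨(s * r * x + p * y).toNat, by rw [Int.toNat_of_nonneg]; linarith⟩
    have hnR : (n : ℝ) = s * r * x + p * y := by exact_mod_cast hn
    have hm : ⌊(n : ℝ) * α⌋ = p * x + ρ * r * y := by
      rw [Int.floor_eq_iff, hnR]
      push_cast
      constructor <;> linarith
    refine ⟨n, Finset.mem_Icc.mpr ⟨?_, ?_⟩, ?_⟩
    · zify; linarith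
    · zify; linarith
    · rw [beattyPoint, hm, hn, Prod.mk.injEq]
      exact ⟨by linear_combination x * hpell, by linear_combination y * hpell⟩

lemma sum_expc_eq_sum_quadPhase (s ρ p r : ℤ) (hpell : p ^ 2 - ρ * s * r ^ 2 = 1) (α ξ : ℝ)
    (M : ℕ) :
    ∑ n ∈ Finset.Icc 1 M, expc (ξ * ((n : ℝ) * (⌊(n : ℝ) * α⌋ : ℝ))) =
      ∑ u ∈ (Finset.Icc 1 M).image (beattyPoint s ρ p r α),
        expc (quadPhase (ξ * (p * s * r)) (ξ * (p ^ 2 + ρ * s * r ^ 2)) (ξ * (ρ * r * p)) u) := by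
  have hp : (p : ℝ) ^ 2 - ρ * s * r ^ 2 = 1 := by exact_mod_cast hpell
  rw [Finset.sum_image]
  · refine Finset.sum_congr rfl fun n _ => ?_
    congr 1
    simp only [quadPhase, beattyPoint]
    push_cast
    set m : ℝ := (⌊(n : ℝ) * α⌋ : ℝ)
    have e1 : (s * r : ℝ) * (p * m - ρ * r * n) + p * (-(s * r) * m + p * n) = n := by
      linear_combination (n : ℝ) * hp
    have e2 : (p : ℝ) * (p * m - ρ * r * n) + ρ * r * (-(s * r) * m + p * n) = m := by
      linear_combination (m : ℝ) * hp
    calc ξ * (n * m) = ξ * (((s * r : ℝ) * (p * m - ρ * r * n) + p * (-(s * r) * m + p * n)) *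
        ((p : ℝ) * (p * m - ρ * r * n) + ρ * r * (-(s * r) * m + p * n))) := by rw [e1, e2]
      _ = _ := by ring
  · intro n _ n' _ h
    simp only [beattyPoint, Prod.mk.injEq] at h
    have : (n : ℤ) = n' := by linear_combination (s * r) * h.1 + p * h.2 + (n' - n) * hpell
    exact_mod_cast this

set_option maxHeartbeats 800000 in
lemma abs_beattyPoint_le (s ρ p r : ℤ) (hs : 0 < s) (hpell : p ^ 2 - ρ * s * r ^ 2 = 1)
    (α : ℝ) (hα : s * α ^ 2 = ρ) (hα1 : 1 ≤ s * α) (κ G : ℝ) (hG : 0 ≤ G)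
    (hE0 : 0 < p + r * (s * α)) (hEG : p + r * (s * α) ≤ G)
    (hGE : G ≤ κ * (p + r * (s * α))) (n : ℕ) (hn : (n : ℝ) ≤ G ^ 2) :
    |((beattyPoint s ρ p r α n).1 : ℝ)| ≤ (2 * (s * α) * κ + s) * G ∧
      |((beattyPoint s ρ p r α n).2 : ℝ)| ≤ (2 * (s * α) * κ + s) * G := by
  have hs1 : (1 : ℝ) ≤ s := by exact_mod_cast hs
  have hp : (p : ℝ) ^ 2 - ρ * s * r ^ 2 = 1 := by exact_mod_cast hpell
  have hs0 : (0 : ℝ) < s := by linarith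
  have hα0 : 0 < α := pos_of_mul_pos_right (by linarith) hs0.le
  have h1 := Int.floor_le ((n : ℝ) * α)
  have h2 := Int.lt_floor_add_one ((n : ℝ) * α)
  have h0 : (0 : ℝ) ≤ (⌊(n : ℝ) * α⌋ : ℝ) := by
    exact_mod_cast Int.floor_nonneg.mpr (by positivity : 0 ≤ (n : ℝ) * α)
  simp only [beattyPoint]
  push_cast
  set m : ℝ := (⌊(n : ℝ) * α⌋ : ℝ)
  set x : ℝ := p * m - ρ * r * n with hx
  set y : ℝ := -(s * r) * m + p * n with hy
  set δ : ℝ := s * α with hδ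
  have hδ2 : δ ^ 2 = ρ * s := by rw [hδ, ← hα]; ring
  set E : ℝ := p + r * δ with hE
  have hX : (s * x + y * δ) * E = s * m + n * δ := by
    rw [hx, hy, hE]
    linear_combination (s * m + n * δ) * hp + (p * r * n - s * r ^ 2 * m) * hδ2
  have hZ : s * x - y * δ = (s * m - n * δ) * E := by
    rw [hx, hy, hE]
    linear_combination n * r * hδ2
  have hXl : 0 ≤ s * x + y * δ := by
    have : 0 ≤ (s * x + y * δ) * E := by rw [hX]; positivity
    exact nonneg_of_mul_nonneg_left this hE0
  have hXu : s * x + y * δ ≤ 2 * δ * κ * G := by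
    have h3 : (s * x + y * δ) * E ≤ 2 * δ * κ * G * E := by
      have h4 := mul_le_mul_of_nonneg_left h1 hs0.le
      have h5 : n * δ ≤ G ^ 2 * δ := by gcongr
      have h6 : G ^ 2 * δ ≤ G * (κ * E) * δ := by rw [sq]; gcongr
      rw [hX]
      have h7 : s * (n * α) = n * δ := by rw [hδ]; ring
      linarith
    exact le_of_mul_le_mul_right h3 hE0
  have hZu : s * x - y * δ ≤ 0 := by
    rw [hZ]
    have h4 : s * m - n * δ ≤ 0 := by
      have := mul_le_mul_of_nonneg_left h1 hs0.le
      rw [hδ]; linarith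
    exact mul_nonpos_of_nonpos_of_nonneg h4 hE0.le
  have hZl : -(s * G) ≤ s * x - y * δ := by
    rw [hZ]
    have h4 : -s ≤ s * m - n * δ := by
      have := mul_le_mul_of_nonneg_left h2.le hs0.le
      rw [hδ]; linarith
    calc -(s * G) ≤ -(s * E) := by gcongr
      _ = -s * E := by ring
      _ ≤ (s * m - n * δ) * E := by gcongr
  have hsx : |s * x| ≤ (2 * δ * κ + s) * G := by
    rw [abs_le]; constructor <;> linarith
  have hyd : |y * δ| ≤ (2 * δ * κ + s) * G := by
    rw [abs_le]; constructor <;> linarith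
  rw [abs_mul, abs_of_pos hs0] at hsx
  rw [abs_mul, abs_of_pos (by linarith : (0 : ℝ) < δ)] at hyd
  exact ⟨(le_mul_of_one_le_left (abs_nonneg x) hs1).trans hsx,
    (le_mul_of_one_le_right (abs_nonneg y) hα1).trans hyd⟩

/-- Simultaneous approximation of `ζ P` and `ζ R`, where `P + R δ` is a unit, yields an
approximation of `ζ` by an element of the quadratic order. -/
lemma exists_quadratic_approx (ζ δ ε₁ ε₂ W : ℝ) (d : ℤ) (P R a b : ℤ) (hδ : δ ^ 2 = d)
    (hPR : P ^ 2 - d * R ^ 2 = 1) (hP : |(P : ℝ)| ≤ W) (hR : |(R : ℝ)| ≤ W) (hδ0 : 0 ≤ δ)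
    (ha : |ζ * P - a| ≤ ε₁) (hb : |ζ * R - b| ≤ ε₂) :
    ∃ u v : ℤ, |(v : ℝ)| ≤ W * (ε₁ + ε₂) ∧
      |ζ - (u - v * δ)| ≤ |P - δ * R| * (ε₁ + δ * ε₂) := by
  have h1 : (P : ℝ) ^ 2 - d * R ^ 2 = 1 := by exact_mod_cast hPR
  have hW : 0 ≤ W := (abs_nonneg _).trans hP
  refine ⟨a * P - d * b * R, a * R - b * P, ?_, ?_⟩
  · have : ((a * R - b * P : ℤ) : ℝ) = P * (ζ * R - b) - R * (ζ * P - a) := by push_cast; ring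
    rw [this]
    calc _ ≤ |P * (ζ * R - b)| + |R * (ζ * P - a)| := abs_sub _ _
      _ = |(P : ℝ)| * |ζ * R - b| + |(R : ℝ)| * |ζ * P - a| := by rw [abs_mul, abs_mul]
      _ ≤ W * ε₂ + W * ε₁ := by gcongr
      _ = _ := by ring
  · have : ζ - (((a * P - d * b * R : ℤ) : ℝ) - ((a * R - b * P : ℤ) : ℝ) * δ) =
        (P - δ * R) * ((ζ * P - a) + δ * (ζ * R - b)) := by
      push_cast
      linear_combination -ζ * h1 + (ζ * R ^ 2 - b * R) * hδ
    rw [this, abs_mul]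
    gcongr
    calc _ ≤ |ζ * P - a| + |δ * (ζ * R - b)| := abs_add_le _ _
      _ ≤ _ := by rw [abs_mul, abs_of_nonneg hδ0]; gcongr

set_option maxHeartbeats 1600000 in
lemma exists_approx_of_large_sum (s ρ p r : ℤ) (hs : 0 < s) (hpell : p ^ 2 - ρ * s * r ^ 2 = 1)
    (α : ℝ) (hα : s * α ^ 2 = ρ) (hα1 : 1 ≤ s * α) (κ : ℝ) (hκ : 1 ≤ κ) (N : ℝ) (hN : 1 ≤ N)
    (hE1 : 1 ≤ p + r * (s * α)) (hEN : p + r * (s * α) ≤ √N)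
    (hNE : √N ≤ κ * (p + r * (s * α))) (ξ T c : ℝ) (hT : 1 ≤ T) (hc : c = 2 * (s * α) * κ + s)
    (hNT : 14 * 360000 * (4 * c ^ 2 * T) ^ 4 ≤ √N)
    (hS : N / T ≤ ‖∑ n ∈ Finset.Icc 1 (⌊N⌋).toNat,
      expc (ξ * ((n : ℝ) * (⌊(n : ℝ) * α⌋ : ℝ)))‖) :
    ∃ q : ℕ, 0 < q ∧ ∃ u v : ℤ, (q : ℝ) ≤ s * (16 * (600 * (4 * c ^ 2 * T) ^ 2) ^ 2) ∧
      |(v : ℝ)| ≤ s * ((s + 1) * (16 * (600 * (4 * c ^ 2 * T) ^ 2) ^ 5)) ∧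
      |q * ξ - (u + v * α)| ≤
        κ ^ 2 * (s + s * α) * (16 * (600 * (4 * c ^ 2 * T) ^ 2) ^ 5) / N ^ 2 := by
  have hs1 : (1 : ℝ) ≤ s := by exact_mod_cast hs
  have hp : (p : ℝ) ^ 2 - ρ * s * r ^ 2 = 1 := by exact_mod_cast hpell
  set δ : ℝ := s * α with hδ
  have hδ2 : δ ^ 2 = ρ * s := by rw [hδ, ← hα]; ring
  set G : ℝ := √N with hG
  have hGN : G ^ 2 = N := Real.sq_sqrt (by linarith)
  have hG1 : 1 ≤ G := Real.one_le_sqrt.mpr hN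
  have hc1 : 1 ≤ c := by rw [hc]; nlinarith [mul_nonneg (by linarith : 0 ≤ δ) (by linarith : 0 ≤ κ)]
  have hc2 : 1 ≤ c ^ 2 := one_le_pow₀ hc1
  set B₀ : ℝ := 4 * c ^ 2 * T with hB₀
  have hB₀1 : 1 ≤ B₀ := by rw [hB₀]; nlinarith
  set L : ℕ := ⌈c * G⌉₊ with hL
  have hLl : c * G ≤ L := Nat.le_ceil _
  have hLu : (L : ℝ) ≤ 2 * (c * G) := by
    have := Nat.ceil_lt_add_one (by positivity : 0 ≤ c * G)
    nlinarith
  have hL2u : (L : ℝ) ^ 2 ≤ 4 * c ^ 2 * N := by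
    calc (L : ℝ) ^ 2 ≤ (2 * (c * G)) ^ 2 := by gcongr
      _ = 4 * c ^ 2 * N := by rw [← hGN]; ring
  have hL2l : N ≤ (L : ℝ) ^ 2 := by
    calc N = G ^ 2 := hGN.symm
      _ ≤ (L : ℝ) ^ 2 := by gcongr; nlinarith
  rw [sum_expc_eq_sum_quadPhase s ρ p r hpell α ξ] at hS
  have hbox : ∀ u ∈ (Finset.Icc 1 ⌊N⌋.toNat).image (beattyPoint s ρ p r α),
      |u.1| ≤ L ∧ |u.2| ≤ L := by
    intro u hu
    obtain ⟨n, hn, rfl⟩ := Finset.mem_image.mp hu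
    have hnN : (n : ℝ) ≤ G ^ 2 := by
      rw [hGN]
      have h1 : (n : ℤ) ≤ ⌊N⌋ := by
        have := (Finset.mem_Icc.mp hn).2
        have : 0 ≤ ⌊N⌋ := Int.floor_nonneg.mpr (by linarith)
        omega
      have h2 : (n : ℝ) ≤ ⌊N⌋ := by exact_mod_cast h1
      exact h2.trans (Int.floor_le _)
    have h := abs_beattyPoint_le s ρ p r hs hpell α hα hα1 κ G (by linarith) (by linarith)
      hEN hNE n hnN
    rw [← hδ, ← hc] at h
    exact ⟨by exact_mod_cast h.1.trans hLl, by exact_mod_cast h.2.trans hLl⟩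
  have hconv : ∀ y x₁ x₂ x₃, (x₁, y) ∈ (Finset.Icc 1 ⌊N⌋.toNat).image (beattyPoint s ρ p r α) →
      (x₃, y) ∈ (Finset.Icc 1 ⌊N⌋.toNat).image (beattyPoint s ρ p r α) → x₁ ≤ x₂ → x₂ ≤ x₃ →
      (x₂, y) ∈ (Finset.Icc 1 ⌊N⌋.toNat).image (beattyPoint s ρ p r α) := by
    intro y x₁ x₂ x₃ h₁ h₃ h₁₂ h₂₃
    rw [mem_image_beattyPoint_iff s ρ p r hpell] at h₁ h₃ ⊢
    have k₁ : (x₁ : ℝ) ≤ x₂ := by exact_mod_cast h₁₂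
    have k₂ : (x₂ : ℝ) ≤ x₃ := by exact_mod_cast h₂₃
    exact ⟨⟨affine_nonneg_of_between k₁ k₂ h₁.1.1 h₃.1.1,
      affine_nonneg_of_between k₁ k₂ h₁.1.2 h₃.1.2⟩,
      affine_nonneg_of_between k₁ k₂ h₁.2.1 h₃.2.1, affine_pos_of_between k₁ k₂ h₁.2.2 h₃.2.2⟩
  have hSL : (L : ℝ) ^ 2 / B₀ ≤ N / T := by
    rw [div_le_div_iff₀ (by linarith) (by linarith), hB₀]
    nlinarith
  obtain ⟨q, hq, hqB, b, a, hb, ha⟩ := exists_common_denominator _ L B₀ hB₀1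
    (hNT.trans (by nlinarith)) hbox hconv _ _ _ (hSL.trans hS)
  set B : ℝ := 16 * (600 * B₀ ^ 2) ^ 5 with hB
  have hBpos : 0 < B := by positivity
  set E : ℝ := p + r * δ with hE
  set F : ℝ := p - r * δ with hF
  have hEF : E * F = 1 := by rw [hE, hF]; linear_combination hp - r ^ 2 * hδ2
  have hF0 : 0 < F := pos_of_mul_pos_right (by linarith) (by linarith : 0 ≤ E)
  have hF1 : F ≤ E := by
    have := le_mul_of_one_le_left hF0.le hE1
    linarith
  have hε : B / L ^ 2 ≤ B / N := by gcongr
  have hE2 : E ^ 2 ≤ N := by rw [← hGN]; gcongr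
  have hF2E : F ^ 2 ≤ E ^ 2 := by gcongr
  have hF2 : F ^ 2 ≤ κ ^ 2 / N := by
    rw [le_div_iff₀ (by linarith)]
    calc F ^ 2 * N = F ^ 2 * G ^ 2 := by rw [hGN]
      _ ≤ F ^ 2 * (κ * E) ^ 2 := by gcongr
      _ = κ ^ 2 * (E * F) ^ 2 := by ring
      _ = κ ^ 2 := by rw [hEF]; ring
  have hPW : |((p ^ 2 + ρ * s * r ^ 2 : ℤ) : ℝ)| ≤ N := by
    have : ((p ^ 2 + ρ * s * r ^ 2 : ℤ) : ℝ) = (E ^ 2 + F ^ 2) / 2 := by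
      push_cast; rw [hE, hF]; linear_combination -r ^ 2 * hδ2
    rw [this, abs_of_nonneg (by positivity)]
    linarith
  have hRW : |((2 * p * r : ℤ) : ℝ)| ≤ N := by
    have h1 : ((2 * p * r : ℤ) : ℝ) * δ = (E ^ 2 - F ^ 2) / 2 := by
      push_cast; rw [hE, hF]; ring
    have h2 : |((2 * p * r : ℤ) : ℝ)| * δ ≤ N := by
      rw [← abs_of_pos (by linarith : 0 < δ), ← abs_mul, h1, abs_le]
      constructor <;> linarith [sq_nonneg F]
    exact (le_mul_of_one_le_right (abs_nonneg _) hα1).trans h2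
  have ha' : |q * s * ξ * ((p ^ 2 + ρ * s * r ^ 2 : ℤ) : ℝ) - ((s * a : ℤ) : ℝ)| ≤ s * (B / N) := by
    have : q * s * ξ * ((p ^ 2 + ρ * s * r ^ 2 : ℤ) : ℝ) - ((s * a : ℤ) : ℝ) =
        s * (q * (ξ * (p ^ 2 + ρ * s * r ^ 2)) - a) := by push_cast; ring
    rw [this, abs_mul, abs_of_pos (by linarith : (0 : ℝ) < s)]
    gcongr
    exact ha.trans hε
  have hb' : |q * s * ξ * ((2 * p * r : ℤ) : ℝ) - (b : ℝ)| ≤ B / N := by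
    have : q * s * ξ * ((2 * p * r : ℤ) : ℝ) - (b : ℝ) = q * (2 * (ξ * (p * s * r))) - b := by
      push_cast; ring
    rw [this]
    exact hb.trans hε
  obtain ⟨u, v, hv, huv⟩ := exists_quadratic_approx (q * s * ξ) δ (s * (B / N)) (B / N) N (ρ * s)
    (p ^ 2 + ρ * s * r ^ 2) (2 * p * r) (s * a) b (by rw [hδ2]; push_cast; ring)
    (by linear_combination (p ^ 2 - ρ * s * r ^ 2 + 1) * hpell) hPW hRW (by linarith) ha' hb'
  obtain ⟨s', rfl⟩ : ∃ s' : ℕ, (s' : ℤ) = s := ⟨s.toNat, by omega⟩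
  have hs' : 0 < s' := by omega
  simp only [Int.cast_natCast] at *
  refine ⟨q * s', by positivity, u, -(v * s'), ?_, ?_, ?_⟩
  · push_cast
    rw [mul_comm]
    gcongr
  · push_cast
    rw [abs_neg, abs_mul, Nat.abs_cast, mul_comm]
    gcongr
    calc _ ≤ _ := hv
      _ = _ := by field_simp
  · have h1 : ((q * s' : ℕ) : ℝ) * ξ - (u + ((-(v * s') : ℤ) : ℝ) * α) =
        q * s' * ξ - (u - v * δ) := by
      push_cast; rw [hδ]; ring
    rw [h1]
    refine huv.trans ?_
    have h2 : ((p ^ 2 + ρ * s' * r ^ 2 : ℤ) : ℝ) - δ * ((2 * p * r : ℤ) : ℝ) = F ^ 2 := by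
      push_cast; rw [hF]; linear_combination -r ^ 2 * hδ2
    rw [h2, abs_of_nonneg (by positivity)]
    calc F ^ 2 * (s' * (B / N) + δ * (B / N)) ≤ κ ^ 2 / N * (s' * (B / N) + δ * (B / N)) := by
          have : 0 ≤ s' * (B / N) + δ * (B / N) := by positivity
          gcongr
      _ = _ := by field_simp

lemma exists_pell_unit (d : ℤ) (hd0 : 0 < d) (hd : ¬IsSquare d) (δ : ℝ) (hδ : δ ^ 2 = d)
    (hδ1 : 1 ≤ δ) :
    ∃ κ : ℝ, 1 < κ ∧ ∀ j : ℕ, ∃ p r : ℤ, p ^ 2 - d * r ^ 2 = 1 ∧ p + r * δ = κ ^ j := by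
  obtain ⟨x, y, hxy, hy⟩ := Pell.exists_of_not_isSquare hd0 hd
  have hx0 : x ≠ 0 := by
    rintro rfl
    have := mul_nonneg hd0.le (sq_nonneg y)
    linarith
  have hx1 : (1 : ℝ) ≤ |x| := by exact_mod_cast Int.one_le_abs hx0
  have hy1 : (1 : ℝ) ≤ |y| := by exact_mod_cast Int.one_le_abs hy
  have habs : |x| ^ 2 - d * |y| ^ 2 = 1 := by rw [sq_abs, sq_abs, hxy]
  refine ⟨|x| + |y| * δ, by nlinarith, fun j => ?_⟩
  induction j with
  | zero => exact ⟨1, 0, by ring, by simp⟩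
  | succ j ih =>
    obtain ⟨p, r, h1, h2⟩ := ih
    refine ⟨p * |x| + d * r * |y|, p * |y| + r * |x|, ?_, ?_⟩
    · linear_combination (|x| ^ 2 - d * |y| ^ 2) * h1 + habs
    · rw [pow_succ, ← h2]
      push_cast
      linear_combination -(r * |(y : ℝ)|) * hδ

lemma exists_approx_of_norm_expSum (k : ℚ) (hk : 0 < k) (hirr : Irrational (√(k : ℝ))) :
    ∃ K : ℝ, 1 ≤ K ∧ ∀ N T ξ : ℝ, 1 ≤ N → 1 ≤ T → K * T ^ 10 ≤ √N →
      1 / T ≤ ‖expSum (k : ℝ) N ξ‖ → ∃ q : ℕ, 0 < q ∧ ∃ u v : ℤ, (q : ℝ) ≤ K * T ^ 10 ∧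
        |(v : ℝ)| ≤ K * T ^ 10 ∧ |q * ξ - (u + v * √(k : ℝ))| ≤ K * T ^ 10 / N ^ 2 := by
  obtain ⟨s, hs⟩ : ∃ s : ℤ, s = k.den := ⟨_, rfl⟩
  obtain ⟨ρ, hρ⟩ : ∃ ρ : ℤ, ρ = k.num := ⟨_, rfl⟩
  have hs0 : 0 < s := by rw [hs]; exact_mod_cast k.den_pos
  have hρ0 : 0 < ρ := by rw [hρ]; exact Rat.num_pos.mpr hk
  have hkR : (0 : ℝ) < k := by exact_mod_cast hk
  set α : ℝ := √(k : ℝ) with hα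
  have hα0 : 0 < α := Real.sqrt_pos.mpr hkR
  have hsα : s * α ^ 2 = ρ := by
    rw [hα, Real.sq_sqrt hkR.le, hs, hρ]
    have := Rat.den_mul_eq_num k
    exact_mod_cast this
  have hδ2 : (s * α) ^ 2 = ((ρ * s : ℤ) : ℝ) := by push_cast; rw [← hsα]; ring
  have hδ1 : 1 ≤ s * α := by
    have h1 : (1 : ℝ) ≤ (s * α) ^ 2 := by
      rw [hδ2]; exact_mod_cast mul_pos hρ0 hs0
    have h2 : (0 : ℝ) < s := by exact_mod_cast hs0
    nlinarith [mul_pos h2 hα0]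
  have hsq : ¬IsSquare (ρ * s) := by
    rintro ⟨z, hz⟩
    have h1 : s * α = |(z : ℝ)| := by
      rw [← abs_of_pos (by linarith : 0 < s * α), ← sq_eq_sq_iff_abs_eq_abs, hδ2, hz]
      push_cast; ring
    have h2 : Irrational (s * α) := hirr.intCast_mul hs0.ne'
    rw [h1] at h2
    exact h2.ne_int |z| (by push_cast; rfl)
  obtain ⟨κ, hκ, hunit⟩ := exists_pell_unit (ρ * s) (mul_pos hρ0 hs0) hsq (s * α) hδ2 hδ1
  obtain ⟨c, hc⟩ : ∃ c : ℝ, c = 2 * (s * α) * κ + s := ⟨_, rfl⟩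
  have hsR : (0 : ℝ) < s := by exact_mod_cast hs0
  obtain ⟨A, hA⟩ : ∃ A : ℝ, A = 14 * 360000 * (4 * c ^ 2) ^ 4 := ⟨_, rfl⟩
  obtain ⟨K₁, hK₁⟩ : ∃ K₁ : ℝ, K₁ = s * (16 * (600 * (4 * c ^ 2) ^ 2) ^ 2) := ⟨_, rfl⟩
  obtain ⟨K₂, hK₂⟩ : ∃ K₂ : ℝ, K₂ = s * ((s + 1) * (16 * (600 * (4 * c ^ 2) ^ 2) ^ 5)) := ⟨_, rfl⟩
  obtain ⟨K₃, hK₃⟩ : ∃ K₃ : ℝ,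
    K₃ = κ ^ 2 * (s + s * α) * (16 * (600 * (4 * c ^ 2) ^ 2) ^ 5) := ⟨_, rfl⟩
  have hA0 : 0 ≤ A := by rw [hA]; positivity
  have hK₁0 : 0 ≤ K₁ := by rw [hK₁]; positivity
  have hK₂0 : 0 ≤ K₂ := by rw [hK₂]; positivity
  have hK₃0 : 0 ≤ K₃ := by rw [hK₃]; positivity
  refine ⟨1 + A + K₁ + K₂ + K₃, by linarith, fun N T ξ hN hT hNT hS => ?_⟩
  have hT4 : T ^ 4 ≤ T ^ 10 := pow_le_pow_right₀ hT (by norm_num)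
  have hT10 : 0 < T ^ 10 := by positivity
  have hbound : ∀ K' : ℝ, K' ≤ 1 + A + K₁ + K₂ + K₃ →
      K' * T ^ 10 ≤ (1 + A + K₁ + K₂ + K₃) * T ^ 10 := fun K' h => by gcongr
  obtain ⟨j, hj1, hj2⟩ := exists_nat_pow_near (Real.one_le_sqrt.mpr hN) hκ
  obtain ⟨p, r, hpell, hpr⟩ := hunit j
  have hNS : N / T ≤ ‖∑ n ∈ Finset.Icc 1 (⌊N⌋).toNat,
      expc (ξ * ((n : ℝ) * (⌊(n : ℝ) * α⌋ : ℝ)))‖ := by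
    rw [expSum, norm_mul, norm_inv, Complex.norm_real, Real.norm_eq_abs,
      abs_of_pos (by linarith), ← div_eq_inv_mul, le_div_iff₀ (by linarith)] at hS
    calc N / T = 1 / T * N := by ring
      _ ≤ _ := hS
  obtain ⟨q, hq, u, v, h1, h2, h3⟩ := exists_approx_of_large_sum s ρ p r hs0 hpell α hsα hδ1 κ hκ.le
    N hN (by rw [hpr]; exact one_le_pow₀ hκ.le) (by rw [hpr]; exact hj1)
    (by rw [hpr, ← pow_succ']; exact hj2.le) ξ T c hT hc
    (by
      calc 14 * 360000 * (4 * c ^ 2 * T) ^ 4 = A * T ^ 4 := by rw [hA]; ring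
        _ ≤ A * T ^ 10 := by gcongr
        _ ≤ _ := (hbound A (by linarith)).trans hNT) hNS
  refine ⟨q, hq, u, v, ?_, ?_, ?_⟩
  · calc (q : ℝ) ≤ _ := h1
      _ = K₁ * T ^ 4 := by rw [hK₁]; ring
      _ ≤ K₁ * T ^ 10 := by gcongr
      _ ≤ _ := hbound _ (by linarith)
  · calc |(v : ℝ)| ≤ _ := h2
      _ = K₂ * T ^ 10 := by rw [hK₂]; ring
      _ ≤ _ := hbound _ (by linarith)
  · refine h3.trans (div_le_div_of_nonneg_right ?_ (by positivity))
    calc _ = K₃ * T ^ 10 := by rw [hK₃]; ring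
      _ ≤ _ := hbound _ (by linarith)

lemma norm_expSum_le_one (k N ξ : ℝ) (hN : 1 ≤ N) : ‖expSum k N ξ‖ ≤ 1 := by
  have h0 : 0 ≤ ⌊N⌋ := Int.floor_nonneg.mpr (by linarith)
  have hfl : ((⌊N⌋.toNat : ℕ) : ℝ) ≤ N := by
    have h1 : ((⌊N⌋.toNat : ℤ) : ℝ) = (⌊N⌋ : ℝ) := by rw [Int.toNat_of_nonneg h0]
    rw [← Int.cast_natCast, h1]
    exact Int.floor_le N
  rw [expSum, norm_mul, norm_inv, Complex.norm_real, Real.norm_eq_abs, abs_of_pos (by linarith),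
    ← div_eq_inv_mul, div_le_one (by linarith)]
  refine (norm_sum_le _ _).trans ?_
  simpa [norm_expc] using hfl

lemma mem_majorArcs_of_approx (k N γ γ' ξ : ℝ) (hξ : ξ ∈ Set.Ico (-(1 / 2) : ℝ) (1 / 2))
    (q : ℕ) (hq : 0 < q) (u v : ℤ) (hqN : (q : ℝ) ≤ N ^ γ) (hvN : |(v : ℝ)| ≤ N ^ γ)
    (h : |q * ξ - (u + v * √k)| ≤ N ^ (-2 + γ')) : ξ ∈ majorArcs k N γ γ' := by
  obtain ⟨g, hg⟩ : ∃ g : ℕ, g = Int.gcd u (Int.gcd v q) := ⟨_, rfl⟩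
  have hgu : (g : ℤ) ∣ u := by rw [hg]; exact Int.gcd_dvd_left ..
  have hgvq : (g : ℤ) ∣ (Int.gcd v q : ℤ) := by rw [hg]; exact Int.gcd_dvd_right ..
  have hgv : (g : ℤ) ∣ v := hgvq.trans (Int.gcd_dvd_left ..)
  have hgq : (g : ℤ) ∣ q := hgvq.trans (Int.gcd_dvd_right ..)
  obtain ⟨u', rfl⟩ := hgu
  obtain ⟨v', rfl⟩ := hgv
  obtain ⟨q', rfl⟩ := Int.natCast_dvd_natCast.mp hgq
  have hg0 : 0 < g := Nat.pos_of_mul_pos_right hq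
  have hq'0 : 0 < q' := Nat.pos_of_mul_pos_left hq
  have hg1 : (1 : ℝ) ≤ g := by exact_mod_cast hg0
  have hq'1 : (1 : ℝ) ≤ q' := by exact_mod_cast hq'0
  have hq'Z : (0 : ℤ) < q' := by exact_mod_cast hq'0
  refine ⟨hξ, (u' - 1) % q' + 1, v', q', ⟨hq'0, ?_, ?_, ?_, ?_, ?_⟩, ?_⟩
  · refine le_trans ?_ hqN
    push_cast
    exact le_mul_of_one_le_left (by linarith) hg1
  · refine le_trans ?_ hvN
    push_cast
    rw [abs_mul, Nat.abs_cast]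
    exact le_mul_of_one_le_left (abs_nonneg _) hg1
  · have := Int.emod_nonneg (u' - 1) hq'Z.ne'
    omega
  · have := Int.emod_lt_of_pos (u' - 1) hq'Z
    omega
  · set a : ℤ := (u' - 1) % q' + 1 with ha
    obtain ⟨e, he⟩ : ∃ e : ℕ, e = Int.gcd a (Int.gcd v' q') := ⟨_, rfl⟩
    have hea : (e : ℤ) ∣ a := by rw [he]; exact Int.gcd_dvd_left ..
    have hevq : (e : ℤ) ∣ (Int.gcd v' q' : ℤ) := by rw [he]; exact Int.gcd_dvd_right ..
    have hev : (e : ℤ) ∣ v' := hevq.trans (Int.gcd_dvd_left ..)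
    have heq : (e : ℤ) ∣ q' := hevq.trans (Int.gcd_dvd_right ..)
    have heu : (e : ℤ) ∣ u' := by
      have : u' = a + q' * ((u' - 1) / q') := by
        have := Int.emod_add_mul_ediv (u' - 1) q'
        omega
      rw [this]
      exact dvd_add hea (heq.mul_right _)
    have hdvd : g * e ∣ g := by
      conv_rhs => rw [hg]
      refine Int.dvd_gcd ?_ ?_
      · push_cast; exact mul_dvd_mul_left _ heu
      · refine Int.natCast_dvd_natCast.mpr (Int.dvd_gcd ?_ ?_)
        · push_cast; exact mul_dvd_mul_left _ hev
        · push_cast; exact mul_dvd_mul_left _ heq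
    rw [← he]
    have h1 : e ∣ 1 := Nat.dvd_of_mul_dvd_mul_left hg0 (by simpa using hdvd)
    exact Nat.dvd_one.mp h1
  · refine (distToInt_le_abs_sub _ ((u' - 1) / q')).trans (le_trans ?_ h)
    have h1 : (u' : ℝ) = ((u' - 1) % q' : ℤ) + 1 + q' * ((u' - 1) / q' : ℤ) := by
      have h2 : u' = (u' - 1) % q' + 1 + q' * ((u' - 1) / q') := by
        have := Int.emod_add_mul_ediv (u' - 1) q'
        omega
      exact_mod_cast h2
    have h3 : ((g * q' : ℕ) : ℝ) * ξ - (((g * u' : ℤ) : ℝ) + ((g * v' : ℤ) : ℝ) * √k) =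
        (g * q') * (ξ - (((((u' - 1) % q' + 1 : ℤ) : ℝ) + v' * √k) / q') -
          (((u' - 1) / q' : ℤ) : ℝ)) := by
      push_cast
      rw [h1]
      field_simp
      ring
    rw [h3, abs_mul, abs_of_pos (by positivity : (0 : ℝ) < g * q')]
    exact le_mul_of_one_le_left (abs_nonneg _) (one_le_mul_of_one_le_of_one_le hg1 hq'1)

/-- **Minor arc estimate** (Proposition: minor arcs).
Let `k` be a positive rational with `√k` irrational.  Then there is an absolute constant
`c₀ > 0` such that for all `γ, γ' ∈ (0, 1/10)` with `γ/γ' < c₀` there exist constants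
`χ = χ(γ, γ') > 0` and `C = C(k, γ, γ') > 0` such that for every `N ≥ 1` and every
`ξ ∈ m(N; k, γ, γ')`, `|(1/N) ∑_{n=1}^{⌊N⌋} e(ξ n⌊n√k⌋)| ≤ C N^{−χ}`. -/
theorem minor_arc_estimate :
    ∃ c₀ > (0 : ℝ), ∀ (γ γ' : ℝ),
      γ ∈ Set.Ioo (0 : ℝ) (1 / 10) → γ' ∈ Set.Ioo (0 : ℝ) (1 / 10) → γ / γ' < c₀ →
      ∃ χ > (0 : ℝ), ∀ (k : ℚ), 0 < k → Irrational (Real.sqrt (k : ℝ)) →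
        ∃ C > (0 : ℝ), ∀ (N : ℝ), 1 ≤ N →
          ∀ ξ ∈ minorArcs (k : ℝ) N γ γ',
            ‖expSum (k : ℝ) N ξ‖ ≤ C * N ^ (-χ) := by
  refine ⟨1, one_pos, fun γ γ' hγ hγ' _ => ?_⟩
  obtain ⟨μ, hμ⟩ : ∃ μ : ℝ, μ = min γ γ' := ⟨_, rfl⟩
  have hμ0 : 0 < μ := by rw [hμ]; exact lt_min hγ.1 hγ'.1
  have hμγ : μ ≤ γ := by rw [hμ]; exact min_le_left _ _
  have hμγ' : μ ≤ γ' := by rw [hμ]; exact min_le_right _ _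
  refine ⟨μ / 20, by positivity, fun k hk hirr => ?_⟩
  obtain ⟨K, hK, hcore⟩ := exists_approx_of_norm_expSum k hk hirr
  have hK0 : 0 ≤ K := by linarith
  obtain ⟨N₀, hN₀⟩ : ∃ N₀ : ℝ, N₀ = K ^ (2 / μ) := ⟨_, rfl⟩
  have hN₀1 : 1 ≤ N₀ := by rw [hN₀]; exact Real.one_le_rpow hK (by positivity)
  have hC1 : 1 ≤ N₀ ^ (μ / 20) := Real.one_le_rpow hN₀1 (by positivity)
  refine ⟨N₀ ^ (μ / 20), by linarith, fun N hN ξ hξ => ?_⟩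
  have hNpos : 0 < N := by linarith
  have hNχ : 0 < N ^ (μ / 20) := Real.rpow_pos_of_pos hNpos _
  rw [Real.rpow_neg hNpos.le, ← div_eq_mul_inv]
  by_contra hlt
  rw [not_le] at hlt
  rcases le_total N N₀ with hNN₀ | hNN₀
  · have h1 : 1 ≤ N₀ ^ (μ / 20) / N ^ (μ / 20) := by
      rw [one_le_div hNχ]
      exact Real.rpow_le_rpow hNpos.le hNN₀ (by positivity)
    linarith [norm_expSum_le_one k N ξ hN]
  · have hS : 1 / N ^ (μ / 20) ≤ ‖expSum (k : ℝ) N ξ‖ := by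
      refine le_trans ?_ hlt.le
      gcongr
    have hKN : K ≤ N ^ (μ / 2) := by
      calc K = N₀ ^ (μ / 2) := by
            rw [hN₀, ← Real.rpow_mul hK0]
            have : 2 / μ * (μ / 2) = 1 := by field_simp
            rw [this, Real.rpow_one]
        _ ≤ _ := Real.rpow_le_rpow (by linarith) hNN₀ (by positivity)
    have hKT : K * (N ^ (μ / 20)) ^ 10 ≤ N ^ μ := by
      have h1 : (N ^ (μ / 20)) ^ 10 = N ^ (μ / 2) := by
        rw [← Real.rpow_natCast, ← Real.rpow_mul hNpos.le]
        congr 1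
        push_cast
        ring
      calc K * (N ^ (μ / 20)) ^ 10 ≤ N ^ (μ / 2) * N ^ (μ / 2) := by rw [h1]; gcongr
        _ = N ^ μ := by rw [← Real.rpow_add hNpos]; congr 1; ring
    have hsqrt : N ^ μ ≤ √N := by
      rw [Real.sqrt_eq_rpow]
      exact Real.rpow_le_rpow_of_exponent_le hN (by linarith [hγ.2])
    have hNγ : N ^ μ ≤ N ^ γ := Real.rpow_le_rpow_of_exponent_le hN hμγ
    obtain ⟨q, hq, u, v, h1, h2, h3⟩ := hcore N (N ^ (μ / 20)) ξ hN
      (Real.one_le_rpow hN (by positivity)) (hKT.trans hsqrt) hS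
    refine hξ.2 (mem_majorArcs_of_approx k N γ γ' ξ hξ.1 q hq u v ((h1.trans hKT).trans hNγ)
      ((h2.trans hKT).trans hNγ) (h3.trans ?_))
    calc K * (N ^ (μ / 20)) ^ 10 / N ^ 2 ≤ N ^ γ' / N ^ 2 := by
          gcongr
          exact hKT.trans (Real.rpow_le_rpow_of_exponent_le hN hμγ')
      _ = N ^ (-2 + γ') := by
          rw [← Real.rpow_natCast, ← Real.rpow_sub hNpos]
          congr 1
          push_cast
          ring
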